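/- arXiv:1711.10233 — 6 statements merged into one kernel-verified Lean document; each statement's English description precedes it below -/
import Mathlib

section
/- Let K be a category whose hom-sets are complete lattices with composition monotone in both arguments and left distributive over non-empty suprema, and let q : M → N be a surjective monoid homomorphism. Let π and π' be lax functors over M on objects X and Y of K, and let f : X → Y be a morphism of K such that f ∘ π_m ≤ π'_m ∘ f for every m ∈ M. Then f ∘ Σ_q(π)_n ≤ Σ_q(π')_n ∘ f for every n ∈ N. -/
open CategoryTheory

universe u v

variable {K : Type u} [Category.{v} K] [∀ X Y : K, CompleteLattice (X ⟶ Y)]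
variable {M N : Type*} [Monoid M] [Monoid N]

/-- `listComp F [n₁, …, n_l]` is the composite `F n₁ ∘ ⋯ ∘ F n_l`
(with `F n_l` applied first), i.e. `F n_l ≫ ⋯ ≫ F n₁`. -/
def listComp {X : K} (F : N → (X ⟶ X)) : List N → (X ⟶ X)
  | [] => 𝟙 X
  | n :: L => listComp F L ≫ F n

/-- `PiAux q π i n` is the family `Π_{n,i}` from the construction of the `q`-saturation. -/
def PiAux (q : M →* N) {X : K} (π : M → (X ⟶ X)) : ℕ → N → (X ⟶ X)
  | 0, n => sSup {g | ∃ m : M, q m = n ∧ g = π m}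
  | i + 1, n => sSup {g | ∃ L : List N, L ≠ [] ∧ L.prod = n ∧ g = listComp (PiAux q π i) L}

/-- `sat q π n` is the `q`-saturation `Σ_q(π)_n = ⨆_{i<ω} Π_{n,i}`. -/
def sat (q : M →* N) {X : K} (π : M → (X ⟶ X)) (n : N) : X ⟶ X :=
  ⨆ i : ℕ, PiAux q π i n


/-- To bound `sSup S ≫ f` it suffices to bound each `g ≫ f` with `g ∈ S`. -/
theorem sSup_comp_le
    (hLD : ∀ {A B C : K} (f : B ⟶ C) (S : Set (A ⟶ B)), S.Nonempty →
      sSup S ≫ f = ⨆ g ∈ S, g ≫ f)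
    {A B C : K} {f : B ⟶ C} {S : Set (A ⟶ B)} (hS : S.Nonempty) {t : A ⟶ C}
    (h : ∀ g ∈ S, g ≫ f ≤ t) : sSup S ≫ f ≤ t :=
  (hLD f S hS).trans_le (iSup₂_le h)

/-- Lax naturality passes to composites along a list. -/
theorem listComp_comp_le
    (hcomp : ∀ {A B C : K} {f f' : A ⟶ B} {g g' : B ⟶ C}, f ≤ f' → g ≤ g' → f ≫ g ≤ f' ≫ g')
    {ι : Type*} {X Y : K} {F : ι → (X ⟶ X)} {F' : ι → (Y ⟶ Y)} {f : X ⟶ Y}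
    (h : ∀ n, F n ≫ f ≤ f ≫ F' n) (L : List ι) :
    listComp F L ≫ f ≤ f ≫ listComp F' L := by
  induction L with
  | nil => simp [listComp]
  | cons n L ih =>
    calc listComp F (n :: L) ≫ f = listComp F L ≫ F n ≫ f := by simp [listComp]
      _ ≤ listComp F L ≫ f ≫ F' n := hcomp le_rfl (h n)
      _ = (listComp F L ≫ f) ≫ F' n := by simp
      _ ≤ (f ≫ listComp F' L) ≫ F' n := hcomp ih le_rfl
      _ = f ≫ listComp F' (n :: L) := by simp [listComp]

/-- Lax naturality passes to every stage of the saturation. -/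
theorem PiAux_comp_le
    (hcomp : ∀ {A B C : K} {f f' : A ⟶ B} {g g' : B ⟶ C}, f ≤ f' → g ≤ g' → f ≫ g ≤ f' ≫ g')
    (hLD : ∀ {A B C : K} (f : B ⟶ C) (S : Set (A ⟶ B)), S.Nonempty →
      sSup S ≫ f = ⨆ g ∈ S, g ≫ f)
    {q : M →* N} (hq : Function.Surjective q)
    {X Y : K} {π : M → (X ⟶ X)} {π' : M → (Y ⟶ Y)} {f : X ⟶ Y}
    (hf : ∀ m : M, π m ≫ f ≤ f ≫ π' m) (i : ℕ) (n : N) :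
    PiAux q π i n ≫ f ≤ f ≫ PiAux q π' i n := by
  induction i generalizing n with
  | zero =>
    simp only [PiAux]
    apply sSup_comp_le hLD
    · obtain ⟨m, hm⟩ := hq n
      exact ⟨_, m, hm, rfl⟩
    · rintro _ ⟨m, hm, rfl⟩
      exact (hf m).trans (hcomp le_rfl (le_sSup ⟨m, hm, rfl⟩))
  | succ i ih =>
    simp only [PiAux]
    apply sSup_comp_le hLD
    · exact ⟨_, [n], by simp, by simp, rfl⟩
    · rintro _ ⟨L, hL, hn, rfl⟩
      exact (listComp_comp_le hcomp ih L).trans (hcomp le_rfl (le_sSup ⟨L, hL, hn, rfl⟩))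

/-- Lax natural transformations are preserved by `q`-saturation: if
`f ∘ π_m ≤ π'_m ∘ f` for all `m ∈ M` then `f ∘ Σ_q(π)_n ≤ Σ_q(π')_n ∘ f` for all `n ∈ N`.
(Here `g ∘ f` in the informal statement is `f ≫ g`.) -/
theorem stmt1
    (hcomp : ∀ {A B C : K} {f f' : A ⟶ B} {g g' : B ⟶ C}, f ≤ f' → g ≤ g' → f ≫ g ≤ f' ≫ g')
    (hLD : ∀ {A B C : K} (f : B ⟶ C) (S : Set (A ⟶ B)), S.Nonempty →
      sSup S ≫ f = ⨆ g ∈ S, g ≫ f)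
    (q : M →* N) (hq : Function.Surjective q)
    {X Y : K} (π : M → (X ⟶ X)) (π' : M → (Y ⟶ Y))
    (hπ1 : 𝟙 X ≤ π 1) (hπmul : ∀ m m' : M, π m' ≫ π m ≤ π (m * m'))
    (hπ'1 : 𝟙 Y ≤ π' 1) (hπ'mul : ∀ m m' : M, π' m' ≫ π' m ≤ π' (m * m'))
    (f : X ⟶ Y)
    (hf : ∀ m : M, π m ≫ f ≤ f ≫ π' m) :
    ∀ n : N, sat q π n ≫ f ≤ f ≫ sat q π' n := by
  intro n
  refine sSup_comp_le hLD (Set.range_nonempty _) ?_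
  rintro _ ⟨i, rfl⟩
  exact (PiAux_comp_le hcomp hLD hq hf i n).trans
    (hcomp le_rfl (le_iSup (fun i => PiAux q π' i n) i))
end

section
/- Let K be a category whose hom-sets are complete lattices such that composition is monotone and preserves non-empty suprema in both arguments (i.e., f ∘ (⨆_i g_i) = ⨆_i (f ∘ g_i) and (⨆_i f_i) ∘ g = ⨆_i (f_i ∘ g) for non-empty families). Let q : M → N be a surjective monoid homomorphism and π a lax functor over M on an object X. Then for every n ∈ N, Σ_q(π)_n = ⨆{π_m | m ∈ M, q(m) = n}. -/
open CategoryTheory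

universe u v

variable {K : Type u} [Category.{v} K] [∀ X Y : K, CompleteLattice (X ⟶ Y)]
variable {M N : Type*} [Monoid M] [Monoid N]

theorem listComp_le
    (hcomp : ∀ {A B C : K} {f f' : A ⟶ B} {g g' : B ⟶ C}, f ≤ f' → g ≤ g' → f ≫ g ≤ f' ≫ g')
    {X : K} {F G : N → (X ⟶ X)} (hFG : ∀ n, F n ≤ G n) (h1 : 𝟙 X ≤ G 1)
    (hmul : ∀ n n' : N, G n' ≫ G n ≤ G (n * n')) (L : List N) :
    listComp F L ≤ G L.prod := by
  induction L with
  | nil => simpa [listComp] using h1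
  | cons n L ih =>
    rw [List.prod_cons]
    exact (hcomp ih (hFG n)).trans (hmul n L.prod)

theorem PiAux_zero_comp_le
    (hLD : ∀ {A B C : K} (f : B ⟶ C) (S : Set (A ⟶ B)), S.Nonempty →
      sSup S ≫ f = ⨆ g ∈ S, g ≫ f)
    (hRD : ∀ {A B C : K} (f : A ⟶ B) (S : Set (B ⟶ C)), S.Nonempty →
      f ≫ sSup S = ⨆ g ∈ S, f ≫ g)
    (q : M →* N) (hq : Function.Surjective q) {X : K} (π : M → (X ⟶ X))
    (hπmul : ∀ m m' : M, π m' ≫ π m ≤ π (m * m')) (n n' : N) :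
    PiAux q π 0 n' ≫ PiAux q π 0 n ≤ PiAux q π 0 (n * n') := by
  have hne : ∀ k : N, {g | ∃ m : M, q m = k ∧ g = π m}.Nonempty := fun k =>
    let ⟨m, hm⟩ := hq k
    ⟨π m, m, hm, rfl⟩
  simp only [PiAux]
  rw [hLD _ _ (hne n')]
  refine iSup₂_le ?_
  rintro _ ⟨m', rfl, rfl⟩
  rw [hRD _ _ (hne n)]
  refine iSup₂_le ?_
  rintro _ ⟨m, rfl, rfl⟩
  exact (hπmul m m').trans (le_sSup ⟨m * m', map_mul q m m', rfl⟩)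

/-- If composition moreover preserves non-empty suprema in both arguments, the formula
for `q`-saturation simplifies: `Σ_q(π)_n = ⨆ {π_m | q m = n}`. -/
theorem stmt3
    (hcomp : ∀ {A B C : K} {f f' : A ⟶ B} {g g' : B ⟶ C}, f ≤ f' → g ≤ g' → f ≫ g ≤ f' ≫ g')
    (hLD : ∀ {A B C : K} (f : B ⟶ C) (S : Set (A ⟶ B)), S.Nonempty →
      sSup S ≫ f = ⨆ g ∈ S, g ≫ f)
    (hRD : ∀ {A B C : K} (f : A ⟶ B) (S : Set (B ⟶ C)), S.Nonempty →
      f ≫ sSup S = ⨆ g ∈ S, f ≫ g)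
    (q : M →* N) (hq : Function.Surjective q)
    {X : K} (π : M → (X ⟶ X))
    (hπ1 : 𝟙 X ≤ π 1) (hπmul : ∀ m m' : M, π m' ≫ π m ≤ π (m * m')) :
    ∀ n : N, sat q π n = sSup {g | ∃ m : M, q m = n ∧ g = π m} := by
  intro n
  have hle : ∀ (i : ℕ) (k : N), PiAux q π i k ≤ PiAux q π 0 k := by
    intro i
    induction i with
    | zero => exact fun _ => le_rfl
    | succ i ih =>
      refine fun k => sSup_le ?_
      rintro _ ⟨L, -, rfl, rfl⟩
      exact listComp_le hcomp ih (hπ1.trans (le_sSup ⟨1, map_one q, rfl⟩))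
        (PiAux_zero_comp_le hLD hRD q hq π hπmul) L
  exact le_antisymm (iSup_le fun i => hle i n) (le_iSup (fun i => PiAux q π i n) 0)
end

section
/- Let K be a category whose hom-sets are complete lattices with composition monotone in both arguments and left distributive over non-empty suprema, and let q : M → N be a surjective monoid homomorphism. Let π and π' be lax functors over M on objects X and Y, and let f : X → Y be a morphism such that both f ∘ (⨆_i g_i) = ⨆_i (f ∘ g_i) and (⨆_i g_i) ∘ f = ⨆_i (g_i ∘ f) for all non-empty families (g_i). If f is strictly natural, i.e. f ∘ π_m = π'_m ∘ f for all m ∈ M, then f ∘ Σ_q(π)_n = Σ_q(π')_n ∘ f for all n ∈ N. -/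
open CategoryTheory

universe u v

variable {K : Type u} [Category.{v} K] [∀ X Y : K, CompleteLattice (X ⟶ Y)]
variable {M N : Type*} [Monoid M] [Monoid N]

/-- If composition with `f` on either side preserves non-empty suprema, then an equality
`F i ≫ f = f ≫ G i` holding for all `i` with `P i` passes to the suprema. -/
theorem sSup_comp_eq_comp_sSup {X Y : K} (f : X ⟶ Y)
    (hfL : ∀ S : Set (X ⟶ X), S.Nonempty → sSup S ≫ f = ⨆ g ∈ S, g ≫ f)
    (hfR : ∀ S : Set (Y ⟶ Y), S.Nonempty → f ≫ sSup S = ⨆ g ∈ S, f ≫ g)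
    {ι : Type*} (P : ι → Prop) (hP : ∃ i, P i) (F : ι → (X ⟶ X)) (G : ι → (Y ⟶ Y))
    (h : ∀ i, P i → F i ≫ f = f ≫ G i) :
    sSup {g | ∃ i, P i ∧ g = F i} ≫ f = f ≫ sSup {g | ∃ i, P i ∧ g = G i} := by
  obtain ⟨i, hi⟩ := hP
  rw [hfL {g | ∃ i, P i ∧ g = F i} ⟨F i, i, hi, rfl⟩,
    hfR {g | ∃ i, P i ∧ g = G i} ⟨G i, i, hi, rfl⟩]
  apply le_antisymm
  · refine iSup₂_le ?_
    rintro _ ⟨j, hj, rfl⟩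
    rw [h j hj]
    exact le_iSup₂_of_le (G j) ⟨j, hj, rfl⟩ le_rfl
  · refine iSup₂_le ?_
    rintro _ ⟨j, hj, rfl⟩
    rw [← h j hj]
    exact le_iSup₂_of_le (F j) ⟨j, hj, rfl⟩ le_rfl

omit [∀ X Y : K, CompleteLattice (X ⟶ Y)] [Monoid N] in
theorem listComp_comp_eq_comp_listComp {X Y : K} (f : X ⟶ Y) (F : N → (X ⟶ X))
    (G : N → (Y ⟶ Y)) (h : ∀ n, F n ≫ f = f ≫ G n) (L : List N) :
    listComp F L ≫ f = f ≫ listComp G L := by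
  induction L with
  | nil => simp [listComp]
  | cons n L ih =>
    simp only [listComp]
    rw [Category.assoc, h, ← Category.assoc, ih, Category.assoc]

/-- Strict natural transformations are preserved by saturation: if composition with `f`
on either side preserves non-empty suprema and `f ∘ π_m = π'_m ∘ f` for all `m`, then
`f ∘ Σ_q(π)_n = Σ_q(π')_n ∘ f` for all `n`.  (Here `g ∘ f` in the informal statement is
`f ≫ g`.) -/
theorem stmt6
    (hcomp : ∀ {A B C : K} {f f' : A ⟶ B} {g g' : B ⟶ C}, f ≤ f' → g ≤ g' → f ≫ g ≤ f' ≫ g')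
    (hLD : ∀ {A B C : K} (f : B ⟶ C) (S : Set (A ⟶ B)), S.Nonempty →
      sSup S ≫ f = ⨆ g ∈ S, g ≫ f)
    (q : M →* N) (hq : Function.Surjective q)
    {X Y : K} (π : M → (X ⟶ X)) (π' : M → (Y ⟶ Y))
    (hπ1 : 𝟙 X ≤ π 1) (hπmul : ∀ m m' : M, π m' ≫ π m ≤ π (m * m'))
    (hπ'1 : 𝟙 Y ≤ π' 1) (hπ'mul : ∀ m m' : M, π' m' ≫ π' m ≤ π' (m * m'))
    (f : X ⟶ Y)
    (hfL : ∀ {W : K} (S : Set (W ⟶ X)), S.Nonempty → sSup S ≫ f = ⨆ g ∈ S, g ≫ f)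
    (hfR : ∀ {Z : K} (S : Set (Y ⟶ Z)), S.Nonempty → f ≫ sSup S = ⨆ g ∈ S, f ≫ g)
    (hf : ∀ m : M, π m ≫ f = f ≫ π' m) :
    ∀ n : N, sat q π n ≫ f = f ≫ sat q π' n := by
  have hPi : ∀ (i : ℕ) (n : N), PiAux q π i n ≫ f = f ≫ PiAux q π' i n := by
    intro i
    induction i with
    | zero =>
      exact fun n => sSup_comp_eq_comp_sSup f hfL hfR _ (hq n) π π' fun m _ => hf m
    | succ i ih =>
      intro n
      simpa only [PiAux, and_assoc] using
        sSup_comp_eq_comp_sSup f hfL hfR (fun L : List N => L ≠ [] ∧ L.prod = n)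
          ⟨[n], by simp⟩ _ _ fun L _ => listComp_comp_eq_comp_listComp f _ _ ih L
  intro n
  have h := sSup_comp_eq_comp_sSup f hfL hfR (fun _ : ℕ => True) ⟨0, trivial⟩
    (PiAux q π · n) (PiAux q π' · n) fun i _ => hPi i n
  simp only [true_and] at h
  simpa only [sat, iSup, Set.range, @eq_comm _ (PiAux _ _ _ _)] using h
end

section
/- Let α be a timed transition system on a set X and let R be an equivalence relation on X with quotient map f : X → X/R. Then R is a timed bisimulation for α if and only if there exists a family of maps β_t : X/R → 𝒫(Σ_τ × X/R), for t ∈ 𝕋, such that f^♯ ∘ α_t = β_t ∘ f^♯ for every t ∈ 𝕋, where ∘ is composition in the Kleisli category of the LTS monad and (α_t) is the functor model of α. -/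
/- `Option Act` models `Σ_τ`: `none` is the silent label `τ`, `some a` is an action. -/

/-- Kleisli composition for the LTS monad: `kcomp g f` is `g ∘ f` (`f` applied first). -/
def kcomp {Act X Y Z : Type*} (g : Y → Set (Option Act × Z)) (f : X → Set (Option Act × Y)) :
    X → Set (Option Act × Z) := fun x =>
  {p | ∃ y : Y, ((p.1, y) ∈ f x ∧ ((none, p.2) : Option Act × Z) ∈ g y) ∨
        (((none, y) : Option Act × Y) ∈ f x ∧ (p.1, p.2) ∈ g y)}

/-- Kleisli lifting `f^♯(x) = {(τ, f x)}` of a function `f`. -/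
def fsharp {Act X Y : Type*} (f : X → Y) : X → Set (Option Act × Y) :=
  fun x => {((none : Option Act), f x)}

/-- `R` is a timed bisimulation for the TTS `α`. -/
def TimedBisim {Act T X : Type*} [AddCommMonoid T]
    (α : X → Set (Option Act × T × X)) (R : X → X → Prop) : Prop :=
  ∀ x y, R x y → ∀ (σ : Option Act) (t : T) (x' : X),
    (σ, t, x') ∈ α x → ∃ y', (σ, t, y') ∈ α y ∧ R x' y'

/-- The functor model `(α_t)_{t ∈ 𝕋}` of a TTS `α`. -/
def funcModel {Act T X : Type*} [AddCommMonoid T]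
    (α : X → Set (Option Act × T × X)) (t : T) : X → Set (Option Act × X) :=
  fun x => {p | (p.1, t, p.2) ∈ α x}

theorem mem_kcomp_fsharp_left {Act X Y Z : Type*} (f : Y → Z) (g : X → Set (Option Act × Y))
    (x : X) (σ : Option Act) (z : Z) :
    (σ, z) ∈ kcomp (fsharp f) g x ↔ ∃ y, (σ, y) ∈ g x ∧ z = f y := by
  simp only [kcomp, fsharp, Set.mem_ofPred_eq, Set.mem_singleton_iff, Prod.mk.injEq, true_and]
  refine exists_congr fun y => ⟨?_, Or.inl⟩
  rintro (h | ⟨h, rfl, hz⟩)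
  exacts [h, ⟨h, hz⟩]

theorem kcomp_fsharp_right {Act X Y Z : Type*} (g : Y → Set (Option Act × Z)) (f : X → Y) (x : X) :
    kcomp g (fsharp f) x = g (f x) := by
  ext ⟨σ, z⟩
  simp only [kcomp, fsharp, Set.mem_ofPred_eq, Set.mem_singleton_iff, Prod.mk.injEq, true_and]
  constructor
  · rintro ⟨y, ⟨⟨rfl, rfl⟩, h⟩ | ⟨rfl, h⟩⟩ <;> exact h
  · exact fun h => ⟨f x, Or.inr ⟨rfl, h⟩⟩

/-- An equivalence relation `R` on `X` is a timed bisimulation for `α` iff there is a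
family `β_t : X/R → 𝒫(Σ_τ × X/R)` with `f^♯ ∘ α_t = β_t ∘ f^♯` for all `t`, where `f` is
the quotient map and `∘` is Kleisli composition for the LTS monad. -/
theorem stmt9 {Act T X : Type*} [AddCommMonoid T]
    (α : X → Set (Option Act × T × X)) (R : X → X → Prop) (hR : Equivalence R) :
    TimedBisim α R ↔
      ∃ β : T → Quotient (⟨R, hR⟩ : Setoid X) → Set (Option Act × Quotient (⟨R, hR⟩ : Setoid X)),
        ∀ t : T,
          kcomp (fsharp (Quotient.mk (⟨R, hR⟩ : Setoid X))) (funcModel α t)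
            = kcomp (β t) (fsharp (Quotient.mk (⟨R, hR⟩ : Setoid X))) := by
  constructor
  · intro h
    have step : ∀ (t : T) (x y : X), R x y →
        kcomp (fsharp (Quotient.mk (⟨R, hR⟩ : Setoid X))) (funcModel α t) x ⊆
          kcomp (fsharp (Quotient.mk (⟨R, hR⟩ : Setoid X))) (funcModel α t) y := by
      rintro t x y hxy ⟨σ, q⟩ hq
      rw [mem_kcomp_fsharp_left] at hq ⊢
      obtain ⟨x', hx', rfl⟩ := hq
      obtain ⟨y', hy', hr⟩ := h x y hxy σ t x' hx'
      exact ⟨y', hy', Quotient.sound hr⟩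
    refine ⟨fun t => Quotient.lift
      (kcomp (fsharp (Quotient.mk (⟨R, hR⟩ : Setoid X))) (funcModel α t))
      fun x y hxy => (step t x y hxy).antisymm (step t y x (hR.symm hxy)), fun t => ?_⟩
    funext x
    rw [kcomp_fsharp_right]
    rfl
  · rintro ⟨β, hβ⟩ x y hxy σ t x' hx'
    have hmem := (mem_kcomp_fsharp_left (Quotient.mk (⟨R, hR⟩ : Setoid X)) (funcModel α t)
      x σ _).2 ⟨x', hx', rfl⟩
    have hq : Quotient.mk (⟨R, hR⟩ : Setoid X) x = Quotient.mk _ y := Quotient.sound hxy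
    rw [hβ, kcomp_fsharp_right, hq, ← kcomp_fsharp_right (β t), ← hβ,
      mem_kcomp_fsharp_left] at hmem
    obtain ⟨y', hy', he⟩ := hmem
    exact ⟨y', hy', Quotient.exact he⟩
end

section
/- Let (Ω, μ) be a probability space, S a finite set, and X : ℕ → Ω → S a stochastic process with each X_n measurable. Fix C ⊆ S. Assume: (positivity) μ({X₀ = i}) > 0 for every i ∈ S; (Markov property instance) for all n ∈ ℕ and i, j ∈ S with μ({X_n = j} ∩ {X₀ = i}) > 0, the conditional probability μ[⋃_{m ≥ n} {X_m ∈ C} | {X_n = j} ∩ {X₀ = i}] equals μ[⋃_{m ≥ n} {X_m ∈ C} | {X_n = j}]; (homogeneity) for all n ∈ ℕ and j ∈ S, μ[⋃_{m ≥ n} {X_m ∈ C} | {X_n = j}] = μ[⋃_{m ≥ 0} {X_m ∈ C} | {X₀ = j}]. Write p_{ij}(n) = μ[{X_n = j} | {X₀ = i}] and p_{i,C} = μ[⋃_{m ≥ 0} {X_m ∈ C} | {X₀ = i}]. Then p_{i,C} = 1 if i ∈ C, and p_{i,C} = ⨆_{n ∈ ℕ} ∑_{j ∈ S} p_{j,C}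 · p_{ij}(n) if i ∉ C. -/
open MeasureTheory ENNReal

/-- The conditional probability `μ[A | B] = μ(A ∩ B) / μ(B)`, taken to be `0` when
`μ(B) = 0`. -/
noncomputable def condP {Ω : Type*} [MeasurableSpace Ω] (μ : Measure Ω) (A B : Set Ω) :
    ℝ≥0∞ :=
  (μ B)⁻¹ * μ (A ∩ B)

theorem condP_mul_self {Ω : Type*} [MeasurableSpace Ω] (μ : Measure Ω) [IsFiniteMeasure μ]
    (A B : Set Ω) : condP μ A B * μ B = μ (A ∩ B) := by
  rcases eq_or_ne (μ B) 0 with h | h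
  · simp [h, measure_mono_null Set.inter_subset_right h]
  · rw [condP, mul_right_comm, ENNReal.inv_mul_cancel h (measure_ne_top μ B), one_mul]

theorem condP_mono {Ω : Type*} [MeasurableSpace Ω] (μ : Measure Ω) {A A' : Set Ω}
    (h : A ⊆ A') (B : Set Ω) : condP μ A B ≤ condP μ A' B := by
  unfold condP
  gcongr

theorem sum_measure_inter_fiber {Ω S : Type*} [MeasurableSpace Ω] [Fintype S]
    [MeasurableSpace S] [MeasurableSingletonClass S] (μ : Measure Ω) {Y : Ω → S}
    (hY : Measurable Y) (E : Set Ω) :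
    ∑ j : S, μ ({ω | Y ω = j} ∩ E) = μ E := by
  have hm (j : S) : MeasurableSet (Y ⁻¹' {j}) := hY (measurableSet_singleton j)
  have h := sum_measure_preimage_singleton (μ := μ.restrict E) (f := Y) Finset.univ
    fun j _ => hm j
  simp only [Finset.coe_univ, Set.preimage_univ, Measure.restrict_apply_univ,
    Measure.restrict_apply (hm _)] at h
  exact h

/-- For a finite-state homogeneous Markov chain `(X_n)` and a set of states `C`, writing
`p_{ij}(n) = μ[{X_n = j} | {X₀ = i}]` and `p_{i,C} = μ[⋃_{m ≥ 0} {X_m ∈ C} | {X₀ = i}]`,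
we have `p_{i,C} = 1` if `i ∈ C`, and
`p_{i,C} = ⨆_n ∑_j p_{j,C} · p_{ij}(n)` otherwise. -/
theorem stmt18 {Ω S : Type*} [MeasurableSpace Ω] [Fintype S]
    [MeasurableSpace S] [MeasurableSingletonClass S]
    (μ : Measure Ω) [IsProbabilityMeasure μ]
    (X : ℕ → Ω → S) (hX : ∀ n, Measurable (X n)) (C : Set S)
    (hpos : ∀ i : S, 0 < μ {ω | X 0 ω = i})
    (hMarkov : ∀ (n : ℕ) (i j : S), 0 < μ ({ω | X n ω = j} ∩ {ω | X 0 ω = i}) →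
      condP μ {ω | ∃ m, n ≤ m ∧ X m ω ∈ C} ({ω | X n ω = j} ∩ {ω | X 0 ω = i})
        = condP μ {ω | ∃ m, n ≤ m ∧ X m ω ∈ C} {ω | X n ω = j})
    (hhom : ∀ (n : ℕ) (j : S),
      condP μ {ω | ∃ m, n ≤ m ∧ X m ω ∈ C} {ω | X n ω = j}
        = condP μ {ω | ∃ m, 0 ≤ m ∧ X m ω ∈ C} {ω | X 0 ω = j}) :
    ∀ i : S,
      (i ∈ C → condP μ {ω | ∃ m, 0 ≤ m ∧ X m ω ∈ C} {ω | X 0 ω = i} = 1) ∧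
      (i ∉ C → condP μ {ω | ∃ m, 0 ≤ m ∧ X m ω ∈ C} {ω | X 0 ω = i}
        = ⨆ n : ℕ, ∑ j : S,
            condP μ {ω | ∃ m, 0 ≤ m ∧ X m ω ∈ C} {ω | X 0 ω = j}
              * condP μ {ω | X n ω = j} {ω | X 0 ω = i}) := by
  intro i
  have hsum (n : ℕ) :
      ∑ j : S, condP μ {ω | ∃ m, 0 ≤ m ∧ X m ω ∈ C} {ω | X 0 ω = j}
          * condP μ {ω | X n ω = j} {ω | X 0 ω = i}
        = condP μ {ω | ∃ m, n ≤ m ∧ X m ω ∈ C} {ω | X 0 ω = i} := by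
    set A := {ω | ∃ m, n ≤ m ∧ X m ω ∈ C}
    set B := {ω | X 0 ω = i}
    have hterm (j : S) :
        condP μ {ω | ∃ m, 0 ≤ m ∧ X m ω ∈ C} {ω | X 0 ω = j} * condP μ {ω | X n ω = j} B
          = (μ B)⁻¹ * μ ({ω | X n ω = j} ∩ (A ∩ B)) := by
      rw [Set.inter_left_comm, ← condP_mul_self μ A, ← hhom n j]
      rcases eq_or_ne (μ ({ω | X n ω = j} ∩ B)) 0 with h | h
      · simp [condP, h]
      · rw [hMarkov n i j (pos_iff_ne_zero.mpr h), mul_left_comm]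
        rfl
    simp_rw [hterm]
    rw [← Finset.mul_sum, sum_measure_inter_fiber μ (hX n)]
    rfl
  refine ⟨fun hi => ?_, fun _ => ?_⟩
  · have hsub : {ω | X 0 ω = i} ⊆ {ω | ∃ m, 0 ≤ m ∧ X m ω ∈ C} := by
      rintro ω rfl
      exact ⟨0, le_rfl, hi⟩
    rw [condP, Set.inter_eq_right.mpr hsub]
    exact ENNReal.inv_mul_cancel (hpos i).ne' (measure_ne_top μ _)
  · simp_rw [hsum]
    refine le_antisymm
      (le_iSup (fun n => condP μ {ω | ∃ m, n ≤ m ∧ X m ω ∈ C} {ω | X 0 ω = i}) 0)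
      (iSup_le fun n => condP_mono μ ?_ _)
    rintro ω ⟨m, -, hm⟩
    exact ⟨m, m.zero_le, hm⟩
end

section
/- Let S be a finite set and Y any set. Matrices S → Y → [0,∞] (and S → S → [0,∞]) are ordered pointwise, forming a complete lattice; for matrices p : S → S → [0,∞] and x : S → Y → [0,∞] define the composite (x ∘ p)(i)(y) = ∑_{j ∈ S} p(i)(j) · x(j)(y). Let π₁ : S → S → [0,∞] be any matrix, let π_n denote its n-fold matrix power under this composition (with π₀ the identity matrix, having 1 on the diagonal and 0 elsewhere), and for a function f : S → Y let f^♯ be the 0–1 matrix with f^♯(i)(y) = 1 if f(i) = y and 0 otherwise. Define G(x) = f^♯ ⊔ ⨆_{n ∈ ℕ} (x ∘ π_n) and H(x) = f^♯ ⊔ (x ∘ π₁). Then ⨆_{l ∈ ℕ} G^l(f^♯) equals the least fixed point of H, i.e. the least matrix x : S → Y → [0,∞] with f^♯ ⊔ (x ∘ π₁) = x. -/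
open ENNReal

/-- `xcomp x p = x ∘ p`: the composite `(x ∘ p)(i)(y) = ∑_j p(i)(j) · x(j)(y)` of a
matrix `x : S → Y → [0,∞]` with a square matrix `p : S → S → [0,∞]`. -/
noncomputable def xcomp {S Y : Type*} [Fintype S]
    (x : S → Y → ℝ≥0∞) (p : S → S → ℝ≥0∞) : S → Y → ℝ≥0∞ :=
  fun i y => ∑ j : S, p i j * x j y

/-- `matPow p n` is the `n`-fold matrix power of `p` (with `matPow p 0` the identity
matrix). -/
noncomputable def matPow {S : Type*} [Fintype S] [DecidableEq S]
    (p : S → S → ℝ≥0∞) : ℕ → S → S → ℝ≥0∞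
  | 0 => fun i j => if i = j then 1 else 0
  | n + 1 => fun i k => ∑ j : S, p i j * matPow p n j k

/-- The 0–1 matrix `f^♯` associated with a function `f : S → Y`. -/
noncomputable def fsharpMat {S Y : Type*} [DecidableEq Y] (f : S → Y) : S → Y → ℝ≥0∞ :=
  fun i y => if f i = y then 1 else 0

section WeightedSystem

variable {S Y : Type*} [Fintype S]

theorem xcomp_mono {x y : S → Y → ℝ≥0∞} (h : x ≤ y) (p : S → S → ℝ≥0∞) :
    xcomp x p ≤ xcomp y p :=
  fun i z => Finset.sum_le_sum fun j _ => mul_le_mul_right (h j z) (p i j)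

theorem xcomp_iSup_of_monotone {u : ℕ → S → Y → ℝ≥0∞} (hu : Monotone u)
    (p : S → S → ℝ≥0∞) : xcomp (⨆ n, u n) p = ⨆ n, xcomp (u n) p := by
  ext i y
  simp only [xcomp, iSup_apply, ENNReal.mul_iSup]
  exact ENNReal.finsetSum_iSup_of_monotone fun j _ _ h => mul_le_mul_right (hu h j y) (p i j)

variable [DecidableEq S]

theorem xcomp_matPow_zero (x : S → Y → ℝ≥0∞) (p : S → S → ℝ≥0∞) :
    xcomp x (matPow p 0) = x := by
  ext i y
  simp [xcomp, matPow]

theorem xcomp_matPow_succ (x : S → Y → ℝ≥0∞) (p : S → S → ℝ≥0∞) (n : ℕ) :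
    xcomp x (matPow p (n + 1)) = xcomp (xcomp x (matPow p n)) p := by
  ext i y
  simp only [xcomp, matPow, Finset.sum_mul, Finset.mul_sum, mul_assoc]
  exact Finset.sum_comm

theorem xcomp_matPow_one (x : S → Y → ℝ≥0∞) (p : S → S → ℝ≥0∞) :
    xcomp x (matPow p 1) = xcomp x p := by
  rw [xcomp_matPow_succ, xcomp_matPow_zero]

theorem xcomp_matPow_le {x : S → Y → ℝ≥0∞} {p : S → S → ℝ≥0∞} (h : xcomp x p ≤ x) (n : ℕ) :
    xcomp x (matPow p n) ≤ x := by
  induction n with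
  | zero => exact (xcomp_matPow_zero x p).le
  | succ n ih =>
    rw [xcomp_matPow_succ]
    exact (xcomp_mono ih p).trans h

end WeightedSystem

/-- With `G(x) = f^♯ ⊔ ⨆_n (x ∘ πₙ)` and `H(x) = f^♯ ⊔ (x ∘ π₁)` (where `πₙ` is the
`n`-th matrix power of `π₁`), the supremum `⨆_l G^l(f^♯)` is the least fixed point of
`H`, i.e. the least matrix `x` with `f^♯ ⊔ (x ∘ π₁) = x`. -/
theorem stmt19 {S Y : Type*} [Fintype S] [DecidableEq S] [DecidableEq Y]
    (p : S → S → ℝ≥0∞) (f : S → Y) :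
    IsLeast {x : S → Y → ℝ≥0∞ | fsharpMat f ⊔ xcomp x p = x}
      (⨆ l : ℕ,
        (fun x : S → Y → ℝ≥0∞ => fsharpMat f ⊔ ⨆ n : ℕ, xcomp x (matPow p n))^[l]
          (fsharpMat f)) := by
  set G : (S → Y → ℝ≥0∞) → S → Y → ℝ≥0∞ :=
    fun x => fsharpMat f ⊔ ⨆ n : ℕ, xcomp x (matPow p n)
  have hGmono : Monotone G := fun x y h =>
    sup_le_sup_left (iSup_mono fun n => xcomp_mono h (matPow p n)) _
  have hchain : Monotone fun l => G^[l] (fsharpMat f) :=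
    hGmono.monotone_iterate_of_le_map le_sup_left
  have hmin : ∀ x, fsharpMat f ⊔ xcomp x p ≤ x → ⨆ l, G^[l] (fsharpMat f) ≤ x := by
    intro x hx
    have hGx : G x ≤ x := sup_le (le_sup_left.trans hx)
      (iSup_le (xcomp_matPow_le (le_sup_right.trans hx)))
    refine iSup_le fun l => ?_
    induction l with
    | zero => exact le_sup_left.trans hx
    | succ l ih =>
      rw [Function.iterate_succ_apply']
      exact (hGmono ih).trans hGx
  have hpre : fsharpMat f ⊔ xcomp (⨆ l, G^[l] (fsharpMat f)) p ≤
      ⨆ l, G^[l] (fsharpMat f) := by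
    refine sup_le (le_iSup (fun l => G^[l] (fsharpMat f)) 0) ?_
    rw [xcomp_iSup_of_monotone hchain]
    refine iSup_le fun l => le_trans ?_ (le_iSup (fun l => G^[l] (fsharpMat f)) (l + 1))
    simp only [Function.iterate_succ_apply']
    rw [← xcomp_matPow_one]
    exact (le_iSup (fun n => xcomp (G^[l] (fsharpMat f)) (matPow p n)) 1).trans le_sup_right
  exact ⟨hpre.antisymm (hmin _ (sup_le_sup_left (xcomp_mono hpre p) _)),
    fun x hx => hmin x (le_of_eq hx)⟩
end
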